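/- With the standard type A_θ hypotheses on (q_{st}) and the listed relations holding in the ℤ^θ-graded algebra B: for all indices with 1 ≤ i < p ≤ r < j ≤ θ one has [x_{u_{ij}}, x_{u_{pr}}]_c = 0. -/

import Mathlib

/-- The degree `e_i ∈ ℤ^θ` of the generator `x_i` (indices are 1-based, degrees are
modeled as finitely supported-looking functions `ℕ → ℤ`). -/
def evec (i : ℕ) : ℕ → ℤ := fun t => if t = i then 1 else 0

/-- The degree `u_{ij} = e_i + e_{i+1} + ⋯ + e_j ∈ ℤ^θ`. -/
def uvec (i j : ℕ) : ℕ → ℤ := fun t => if i ≤ t ∧ t ≤ j then 1 else 0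

/-- Braided commutator of (homogeneous) elements `u, v` of degrees `α, β`:
`[u, v]_c = uv − χ(α, β) vu`. -/
def bra {k : Type*} [Field k] {B : Type*} [Ring B] [Algebra k B]
    (χ : (ℕ → ℤ) → (ℕ → ℤ) → k) (α : ℕ → ℤ) (u : B) (β : ℕ → ℤ) (v : B) : B :=
  u * v - χ α β • (v * u)

/-- The iterated root vector `x_{u_{ij}}`, defined by `x_{u_{ii}} = x_i` and
`x_{u_{ij}} = [x_i, x_{u_{i+1,j}}]_c` for `i < j`. -/
def xu {k : Type*} [Field k] {B : Type*} [Ring B] [Algebra k B]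
    (χ : (ℕ → ℤ) → (ℕ → ℤ) → k) (x : ℕ → B) (i j : ℕ) : B :=
  if h : j ≤ i then x i
  else bra χ (evec i) (x i) (uvec (i + 1) j) (xu χ x (i + 1) j)
termination_by j - i
decreasing_by omega


section helpers
variable {k : Type*} [Field k] {B : Type*} [Ring B] [Algebra k B]
  (χ : (ℕ → ℤ) → (ℕ → ℤ) → k)

theorem aux_L1 (hχ₁ : ∀ a b c, χ (a + b) c = χ a c * χ b c)
    (α β γ : ℕ → ℤ) (u v w : B)
    (h1 : bra χ α u γ w = 0) (h2 : bra χ β v γ w = 0) :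
    bra χ (α + β) (bra χ α u β v) γ w = 0 := by
  have e : bra χ (α + β) (bra χ α u β v) γ w =
      u * bra χ β v γ w + χ β γ • (bra χ α u γ w * v)
      - χ α β • (v * bra χ α u γ w) - (χ α β * χ α γ) • (bra χ β v γ w * u) := by
    simp only [bra, hχ₁, mul_sub, sub_mul, smul_sub, smul_smul, mul_assoc,
      mul_smul_comm, smul_mul_assoc]
    module
  rw [e, h1, h2]; simp

theorem aux_L3 (hχ₁ : ∀ a b c, χ (a + b) c = χ a c * χ b c)
    (hχ₂ : ∀ a b c, χ a (b + c) = χ a b * χ a c)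
    (α β γ : ℕ → ℤ) (u v w : B)
    (h1 : bra χ α u γ w = 0) :
    bra χ (α + β) (bra χ α u β v) γ w = bra χ α u (β + γ) (bra χ β v γ w) := by
  have e : bra χ (α + β) (bra χ α u β v) γ w = bra χ α u (β + γ) (bra χ β v γ w)
      + χ β γ • (bra χ α u γ w * v) - χ α β • (v * bra χ α u γ w) := by
    simp only [bra, hχ₁, hχ₂, mul_sub, sub_mul, smul_sub, smul_smul, mul_assoc,
      mul_smul_comm, smul_mul_assoc]
    module
  rw [e, h1]; simp

theorem aux_L2 (hχ₁ : ∀ a b c, χ (a + b) c = χ a c * χ b c)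
    (hχ₂ : ∀ a b c, χ a (b + c) = χ a b * χ a c)
    (α β γ : ℕ → ℤ) (u v w : B)
    (h1 : bra χ α u β v = 0) (h2 : bra χ α u γ w = 0) :
    bra χ α u (β + γ) (bra χ β v γ w) = 0 := by
  rw [← aux_L3 χ hχ₁ hχ₂ α β γ u v w h2, h1]; simp [bra]

theorem aux_uvec_self (i : ℕ) : uvec i i = evec i := by
  funext t; simp only [uvec, evec]; congr 1; apply propext; omega

theorem aux_uvec_add (i m j : ℕ) (h1 : i ≤ m) (h2 : m < j) :
    uvec i j = uvec i m + uvec (m + 1) j := by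
  funext t; simp only [uvec, Pi.add_apply]; split_ifs <;> omega

theorem aux_xu_self (x : ℕ → B) (i : ℕ) : xu χ x i i = x i := by
  rw [xu]; simp

theorem aux_xu_lt (x : ℕ → B) (i j : ℕ) (h : i < j) :
    xu χ x i j = bra χ (uvec i i) (xu χ x i i) (uvec (i + 1) j) (xu χ x (i + 1) j) := by
  rw [aux_xu_self, aux_uvec_self, xu, dif_neg (by omega)]

/-- if `u` braided-commutes with each letter, it does with `x_{pr}` -/
theorem aux_right (hχ₁ : ∀ a b c, χ (a + b) c = χ a c * χ b c)
    (hχ₂ : ∀ a b c, χ a (b + c) = χ a b * χ a c) (x : ℕ → B)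
    (α : ℕ → ℤ) (u : B) (r : ℕ) : ∀ n p, p + n = r →
    (∀ s, p ≤ s → s ≤ r → bra χ α u (evec s) (x s) = 0) →
      bra χ α u (uvec p r) (xu χ x p r) = 0 := by
  intro n
  induction n with
  | zero =>
    intro p hp h
    obtain rfl : p = r := by omega
    rw [aux_xu_self, aux_uvec_self]
    exact h p le_rfl le_rfl
  | succ n ih =>
    intro p hp h
    rw [aux_xu_lt χ x p r (by omega), aux_uvec_add p p r le_rfl (by omega)]
    refine aux_L2 χ hχ₁ hχ₂ _ _ _ _ _ _ ?_ ?_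
    · rw [aux_xu_self, aux_uvec_self]
      exact h p le_rfl (by omega)
    · exact ih (p + 1) (by omega) (fun s h1 h2 => h s (by omega) h2)

theorem aux_left (hχ₁ : ∀ a b c, χ (a + b) c = χ a c * χ b c) (x : ℕ → B)
    (α : ℕ → ℤ) (u : B) (r : ℕ) : ∀ n p, p + n = r →
    (∀ s, p ≤ s → s ≤ r → bra χ (evec s) (x s) α u = 0) →
      bra χ (uvec p r) (xu χ x p r) α u = 0 := by
  intro n
  induction n with
  | zero =>
    intro p hp h
    obtain rfl : p = r := by omega
    rw [aux_xu_self, aux_uvec_self]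
    exact h p le_rfl le_rfl
  | succ n ih =>
    intro p hp h
    rw [aux_xu_lt χ x p r (by omega), aux_uvec_add p p r le_rfl (by omega)]
    refine aux_L1 χ hχ₁ _ _ _ _ _ _ ?_ ?_
    · rw [aux_xu_self, aux_uvec_self]
      exact h p le_rfl (by omega)
    · exact ih (p + 1) (by omega) (fun s h1 h2 => h s (by omega) h2)

end helpers

/-- Lemma: `[x_{u_{ij}}, x_{u_{pr}}]_c = 0` for `i < p ≤ r < j`. -/
theorem stmt_6 {k : Type*} [Field k] {B : Type*} [Ring B] [Algebra k B]
    -- the braiding matrix, of standard type A_θ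
    (θ : ℕ) (hθ : 2 ≤ θ) (q : ℕ → ℕ → k) (q0 : k) (hq00 : q0 ≠ 0) (hq01 : q0 ≠ 1)
    (hq : ∀ s t, 1 ≤ s → s ≤ θ → 1 ≤ t → t ≤ θ → q s t ≠ 0)
    (hfar : ∀ s t, 1 ≤ s → s ≤ θ → 1 ≤ t → t ≤ θ → (s + 1 < t ∨ t + 1 < s) →
      q s t * q t s = 1)
    (hadjt : ∀ s, 1 ≤ s → s + 1 ≤ θ →
      q s (s + 1) * q (s + 1) s = q0 ∨ q s (s + 1) * q (s + 1) s = q0⁻¹)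
    (hdiag : ∀ s, 1 ≤ s → s ≤ θ →
      (q s s = -1 ∧ (1 < s → s < θ →
          (q (s - 1) s * q s (s - 1)) * (q s (s + 1) * q (s + 1) s) = 1)) ∨
      (q s s ≠ -1 ∧ (q s s = q0 ∨ q s s = q0⁻¹) ∧
        (s < θ → q s s * (q s (s + 1) * q (s + 1) s) = 1) ∧
        (1 < s → q s s * (q (s - 1) s * q s (s - 1)) = 1)))
    -- the associated bicharacter
    (χ : (ℕ → ℤ) → (ℕ → ℤ) → k)
    (hχ₁ : ∀ a b c, χ (a + b) c = χ a c * χ b c)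
    (hχ₂ : ∀ a b c, χ a (b + c) = χ a b * χ a c)
    (hχq : ∀ s t, 1 ≤ s → s ≤ θ → 1 ≤ t → t ≤ θ → χ (evec s) (evec t) = q s t)
    -- the ℤ^θ-graded algebra B with its generators x_i of degree e_i
    (x : ℕ → B) (𝒜 : (ℕ → ℤ) → Submodule k B)
    (hgr : ∀ (α β : ℕ → ℤ) (a b : B), a ∈ 𝒜 α → b ∈ 𝒜 β → a * b ∈ 𝒜 (α + β))
    (hxdeg : ∀ i, 1 ≤ i → i ≤ θ → x i ∈ 𝒜 (evec i))
    -- the relations assumed to hold in B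
    (hnil : ∀ i, 1 ≤ i → i ≤ θ → q i i = -1 → x i ^ 2 = 0)
    (hrel1 : ∀ i j, 1 ≤ i → i ≤ θ → 1 ≤ j → j ≤ θ → (i + 1 < j ∨ j + 1 < i) →
      bra χ (evec i) (x i) (evec j) (x j) = 0)
    (hrel2 : ∀ i j, 1 ≤ i → i ≤ θ → 1 ≤ j → j ≤ θ → (i + 1 = j ∨ j + 1 = i) →
      bra χ (evec i) (x i) (evec i + evec j) (bra χ (evec i) (x i) (evec j) (x j)) = 0)
    (hrel3 : ∀ i, 1 ≤ i → i + 2 ≤ θ →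
      bra χ (evec i + (evec (i + 1) + evec (i + 2)))
        (bra χ (evec i) (x i) (evec (i + 1) + evec (i + 2))
          (bra χ (evec (i + 1)) (x (i + 1)) (evec (i + 2)) (x (i + 2))))
        (evec (i + 1)) (x (i + 1)) = 0) :
    ∀ i p r j, 1 ≤ i → i < p → p ≤ r → r < j → j ≤ θ →
      bra χ (uvec i j) (xu χ x i j) (uvec p r) (xu χ x p r) = 0 := by
  have far : ∀ i m p j, 1 ≤ i → i ≤ m → m + 1 < p → p ≤ j → j ≤ θ →
      bra χ (uvec i m) (xu χ x i m) (uvec p j) (xu χ x p j) = 0 := by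
    intro i m p j h1 h2 h3 h4 h5
    refine aux_right χ hχ₁ hχ₂ x _ _ j (j - p) p (by omega) (fun s hs hs' => ?_)
    refine aux_left χ hχ₁ x _ _ m (m - i) i (by omega) (fun t ht ht' => ?_)
    exact hrel1 t s (by omega) (by omega) (by omega) (by omega) (by omega)
  have split : ∀ m j, m < j → j ≤ θ → ∀ n i, i + n = m → 1 ≤ i →
      xu χ x i j = bra χ (uvec i m) (xu χ x i m) (uvec (m + 1) j) (xu χ x (m + 1) j) := by
    intro m j hm hj n
    induction n with
    | zero =>
      intro i hi _
      obtain rfl : i = m := by omega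
      exact aux_xu_lt χ x i j hm
    | succ n ih =>
      intro i hi h1
      rw [aux_xu_lt χ x i j (by omega), aux_xu_lt χ x i m (by omega),
        aux_uvec_add i i m le_rfl (by omega),
        aux_L3 χ hχ₁ hχ₂ _ _ _ _ _ _
          (far i i (m + 1) j h1 le_rfl (by omega) (by omega) hj),
        ← ih (i + 1) (by omega) (by omega), ← aux_uvec_add (i + 1) m j (by omega) hm]
  have step3 : ∀ i j, 1 ≤ i → i + 2 ≤ j → j ≤ θ →
      bra χ (uvec i j) (xu χ x i j) (evec (i + 1)) (x (i + 1)) = 0 := by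
    intro i j h1 h2 h3
    have base : bra χ (uvec i (i + 2)) (xu χ x i (i + 2)) (evec (i + 1)) (x (i + 1)) = 0 := by
      have := hrel3 i h1 (by omega)
      rw [aux_xu_lt χ x i (i + 2) (by omega), aux_xu_lt χ x (i + 1) (i + 2) (by omega),
        aux_uvec_add i i (i + 2) le_rfl (by omega),
        aux_uvec_add (i + 1) (i + 1) (i + 2) le_rfl (by omega)]
      simpa only [aux_xu_self, aux_uvec_self] using this
    rcases Nat.eq_or_lt_of_le h2 with h | h
    · rw [← h]; exact base
    · rw [split (i + 2) j h h3 2 i rfl h1, aux_uvec_add i (i + 2) j (by omega) h]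
      refine aux_L1 χ hχ₁ _ _ _ _ _ _ base ?_
      refine aux_left χ hχ₁ x _ _ j (j - (i + 2 + 1)) _ (by omega) (fun t ht ht' => ?_)
      exact hrel1 t _ (by omega) (by omega) (by omega) (by omega) (by omega)
  intro i p r j h1 h2 h3 h4 h5
  refine aux_right χ hχ₁ hχ₂ x _ _ r (r - p) p (by omega) (fun s hs hs' => ?_)
  obtain ⟨m, rfl⟩ : ∃ m, s = m + 1 := ⟨s - 1, by omega⟩
  rcases Nat.eq_or_lt_of_le (show i ≤ m by omega) with h | h
  · subst h
    exact step3 i j h1 (by omega) h5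
  · obtain ⟨l, rfl⟩ : ∃ l, m = l + 1 := ⟨m - 1, by omega⟩
    rw [split l j (by omega) h5 (l - i) i (by omega) h1,
      aux_uvec_add i l j (by omega) (by omega)]
    refine aux_L1 χ hχ₁ _ _ _ _ _ _ ?_ (step3 (l + 1) j (by omega) (by omega) h5)
    refine aux_left χ hχ₁ x _ _ l (l - i) i (by omega) (fun t ht ht' => ?_)
    exact hrel1 t _ (by omega) (by omega) (by omega) (by omega) (by omega)
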